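/- Let k be a field of characteristic zero, and let ρ be the k-algebra automorphism of F = k(x,y) with ρ(x) = y^{-1} and ρ(y) = x (a Poisson monomial automorphism of order 4). Then the fixed field F^ρ is Poisson-isomorphic to F. -/

import Mathlib

noncomputable section

/-- A Poisson bracket on a commutative `k`-algebra `R`: a `k`-bilinear antisymmetric map
satisfying the Jacobi identity and the Leibniz rule in each argument. -/
structure PoissonBracket (k R : Type*) [CommRing k] [CommRing R] [Algebra k R] where
  bracket : R →ₗ[k] R →ₗ[k] R
  antisymm : ∀ a b : R, bracket a b = - bracket b a
  jacobi : ∀ a b c : R,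
    bracket a (bracket b c) + bracket b (bracket c a) + bracket c (bracket a b) = 0
  leibniz : ∀ a b c : R, bracket a (b * c) = bracket a b * c + b * bracket a c

/-- The subalgebra of elements fixed by an algebra automorphism. -/
def fixedSubalgebra {k F : Type*} [CommSemiring k] [CommSemiring F] [Algebra k F]
    (σ : F ≃ₐ[k] F) : Subalgebra k F where
  carrier := {a | σ a = a}
  mul_mem' := fun {a b} ha hb => by
    show σ (a * b) = a * b
    rw [map_mul, show σ a = a from ha, show σ b = b from hb]
  add_mem' := fun {a b} ha hb => by
    show σ (a + b) = a + b
    rw [map_add, show σ a = a from ha, show σ b = b from hb]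
  one_mem' := map_one σ
  zero_mem' := map_zero σ
  algebraMap_mem' := fun r => σ.commutes r

open IntermediateField

namespace PoissonBracket

section CommRing

variable {k R : Type*} [CommRing k] [CommRing R] [Algebra k R] (P : PoissonBracket k R)

/-- The Hamiltonian derivation `{a, ·}`. -/
def hamiltonian (a : R) : Derivation k R R :=
  Derivation.mk' (P.bracket a) fun b c => by
    rw [P.leibniz, smul_eq_mul, smul_eq_mul]; ring

theorem hamiltonian_apply (a b : R) : P.hamiltonian a b = P.bracket a b := rfl

theorem bracket_algebraMap_right (a : R) (c : k) : P.bracket a (algebraMap k R c) = 0 :=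
  (P.hamiltonian a).map_algebraMap c

theorem bracket_ofNat_right (a : R) (n : ℕ) [n.AtLeastTwo] :
    P.bracket a (ofNat(n) : R) = 0 :=
  (P.hamiltonian a).map_natCast n

theorem bracket_one_right (a : R) : P.bracket a 1 = 0 :=
  (P.hamiltonian a).map_one_eq_zero

theorem bracket_one_left (a : R) : P.bracket 1 a = 0 := by
  rw [P.antisymm, bracket_one_right, neg_zero]

theorem bracket_ofNat_left (a : R) (n : ℕ) [n.AtLeastTwo] :
    P.bracket (ofNat(n) : R) a = 0 := by
  rw [P.antisymm, bracket_ofNat_right, neg_zero]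

theorem leibniz_left (a b c : R) :
    P.bracket (a * b) c = P.bracket a c * b + a * P.bracket b c := by
  rw [P.antisymm, P.leibniz, P.antisymm a, P.antisymm b]; ring

end CommRing

section Field

variable {k F : Type*} [Field k] [Field F] [Algebra k F] (P : PoissonBracket k F)

theorem bracket_self [CharZero F] (a : F) : P.bracket a a = 0 :=
  self_eq_neg.mp (P.antisymm a a)

theorem bracket_inv_right (a b : F) : P.bracket a b⁻¹ = -P.bracket a b / b ^ 2 := by
  have := (P.hamiltonian a).leibniz_inv b
  rw [hamiltonian_apply, hamiltonian_apply, smul_eq_mul] at this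
  rw [this, div_eq_mul_inv, inv_pow]; ring

theorem bracket_inv_left (a b : F) : P.bracket a⁻¹ b = -P.bracket a b / a ^ 2 := by
  rw [P.antisymm, bracket_inv_right, P.antisymm b]; ring

theorem bracket_div_right (a b : F) {c : F} (hc : c ≠ 0) :
    P.bracket a (b / c) = (P.bracket a b * c - b * P.bracket a c) / c ^ 2 := by
  rw [div_eq_mul_inv, P.leibniz, bracket_inv_right]; field_simp; ring

theorem bracket_div_left (a b : F) {c : F} (hc : c ≠ 0) :
    P.bracket (a / c) b = (P.bracket a b * c - a * P.bracket c b) / c ^ 2 := by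
  rw [P.antisymm, P.bracket_div_right _ _ hc, P.antisymm b, P.antisymm b]; ring

/-- An algebra endomorphism of a field generated by two elements is Poisson as soon as it
respects the bracket of the generators. -/
theorem map_bracket_of_generators [CharZero F] {x y : F} (hgen : adjoin k {x, y} = ⊤)
    (φ : F →ₐ[k] F) (h : φ (P.bracket y x) = P.bracket (φ y) (φ x)) (a b : F) :
    φ (P.bracket a b) = P.bracket (φ a) (φ b) := by
  have extend : ∀ c, φ (P.bracket c x) = P.bracket (φ c) (φ x) →
      φ (P.bracket c y) = P.bracket (φ c) (φ y) →
      ∀ b, φ (P.bracket c b) = P.bracket (φ c) (φ b) := by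
    intro c hx hy b
    have hb : b ∈ adjoin k {x, y} := hgen ▸ mem_top
    induction hb using adjoin_induction with
    | mem b hb =>
      rcases hb with rfl | rfl
      exacts [hx, hy]
    | algebraMap r => simp [bracket_algebraMap_right]
    | add a b _ _ ha hb => simp [ha, hb]
    | inv a _ ha => simp [bracket_inv_right, ha]
    | mul a b _ _ ha hb => simp [P.leibniz, ha, hb]
  have flip : ∀ a b, φ (P.bracket a b) = P.bracket (φ a) (φ b) →
      φ (P.bracket b a) = P.bracket (φ b) (φ a) := by
    intro a b hab
    rw [P.antisymm, map_neg, hab, ← P.antisymm]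
  exact extend a (flip _ _ (extend x (by simp [bracket_self]) (flip _ _ h) a))
    (flip _ _ (extend y h (by simp [bracket_self]) a)) b

end Field

end PoissonBracket

theorem isIntegral_of_quartic {k F : Type*} [Field k] [Field F] [Algebra k F]
    {K : IntermediateField k F} {x A C : F} (hA : A ∈ K) (hC : C ∈ K)
    (hquartic : x ^ 4 = A * x ^ 3 - C * x ^ 2 + A * x - 1) : IsIntegral K x := by
  refine ⟨Polynomial.X ^ 4 - (Polynomial.C ⟨A, hA⟩ * Polynomial.X ^ 3
    - Polynomial.C ⟨C, hC⟩ * Polynomial.X ^ 2 + Polynomial.C ⟨A, hA⟩ * Polynomial.X - 1), ?_, ?_⟩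
  · monicity!
  · have h1 : algebraMap K F ⟨A, hA⟩ = A := rfl
    have h2 : algebraMap K F ⟨C, hC⟩ = C := rfl
    simp [h1, h2, hquartic]

/-- A trace argument: if `F` is generated over `K` by a root `x` of a quartic and the power sums
of `x` along `σ` lie in `K`, then every fixed element of `σ` lies in `K`. -/
theorem mem_of_fixed_of_quartic {k F : Type*} [Field k] [Field F] [CharZero F] [Algebra k F]
    (K : IntermediateField k F) (σ : F ≃ₐ[k] F) (hK : ∀ a ∈ K, σ a = a)
    (x : F) (hx : K⟮x⟯ = ⊤) {A C : F} (hA : A ∈ K) (hC : C ∈ K)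
    (hquartic : x ^ 4 = A * x ^ 3 - C * x ^ 2 + A * x - 1)
    (htrace : ∀ n < 4, x ^ n + σ (x ^ n) + σ (σ (x ^ n)) + σ (σ (σ (x ^ n))) ∈ K)
    {f : F} (hf : σ f = f) : f ∈ K := by
  have hpow : ∀ n, x ^ n + σ (x ^ n) + σ (σ (x ^ n)) + σ (σ (σ (x ^ n))) ∈ K := by
    intro n
    induction n using Nat.strong_induction_on with
    | _ n ih =>
      by_cases hn : n < 4
      · exact htrace n hn
      obtain ⟨m, rfl⟩ := Nat.exists_eq_add_of_le' (not_lt.mp hn)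
      have hrec : x ^ (m + 4) = A * x ^ (m + 3) - C * x ^ (m + 2) + A * x ^ (m + 1) - x ^ m := by
        rw [pow_add, hquartic]; ring
      have h3 := K.mul_mem hA (ih (m + 3) (by omega))
      have h2 := K.mul_mem hC (ih (m + 2) (by omega))
      have h1 := K.mul_mem hA (ih (m + 1) (by omega))
      have h0 := ih m (by omega)
      have := K.sub_mem (K.add_mem (K.sub_mem h3 h2) h1) h0
      rw [hrec]
      simp only [map_add, map_sub, map_mul, hK A hA, hK C hC]
      convert this using 1
      ring
  have hint := isIntegral_of_quartic hA hC hquartic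
  have hmem : f ∈ Algebra.adjoin K {x} := by
    rw [← adjoin_simple_toSubalgebra_of_isAlgebraic hint.isAlgebraic, hx]
    exact mem_top
  have htr : f + σ f + σ (σ f) + σ (σ (σ f)) ∈ K := by
    rw [Algebra.adjoin_singleton_eq_range_aeval] at hmem
    obtain ⟨q, rfl⟩ := hmem
    clear hf
    induction q using Polynomial.induction_on' with
    | add p q hp hq =>
      simp only [map_add] at hp hq ⊢
      convert K.add_mem hp hq using 1
      ring
    | monomial n a =>
      have ha : σ (algebraMap K F a) = algebraMap K F a := hK _ a.2
      convert K.mul_mem a.2 (hpow n) using 1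
      simp only [AlgHom.toRingHom_eq_coe, RingHom.coe_coe, Polynomial.aeval_monomial, map_mul, ha]
      change (a : F) * _ + (a : F) * _ + (a : F) * _ + (a : F) * _ = _
      ring
  simp only [hf] at htr
  have h4 : f = (f + f + f + f) / 4 := by ring
  rw [h4]
  exact K.div_mem htr (ofNat_mem K 4)

/-- Logarithmic coordinates for the bracket `{z, s} = s (z² - s² - 1) / 2`. -/
theorem exists_generators_of_bracket_eq {k F : Type*} [Field k] [Field F] [CharZero F]
    [Algebra k F] (P : PoissonBracket k F) {z s : F} (hs : s ≠ 0)
    (hzs : P.bracket z s = s * (z ^ 2 - s ^ 2 - 1) / 2) (hne : P.bracket z s ≠ 0) :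
    ∃ u v : F, P.bracket u v = u * v ∧ adjoin k {v, u} = adjoin k {z, s} := by
  obtain ⟨α, hα⟩ : ∃ α, α = z - s := ⟨_, rfl⟩
  obtain ⟨g, hg⟩ : ∃ g, g = z ^ 2 - s ^ 2 - 1 := ⟨_, rfl⟩
  have hz : z = α + s := by rw [hα]; ring
  have hg' : g = α ^ 2 + 2 * α * s - 1 := by rw [hg, hz]; ring
  rw [← hg] at hzs
  have hαs : P.bracket α s = s * g / 2 := by
    rw [hα, map_sub, LinearMap.sub_apply, P.bracket_self, hzs, sub_zero]
  have hg0 : g ≠ 0 := by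
    rintro h
    rw [hzs, h] at hne
    simp at hne
  have hsg : s * g / 2 ≠ 0 := div_ne_zero (mul_ne_zero hs hg0) two_ne_zero
  have hα0 : α ≠ 0 := by
    rintro h
    rw [h, map_zero, LinearMap.zero_apply] at hαs
    exact hsg hαs.symm
  have hα1 : α - 1 ≠ 0 := by
    intro h
    rw [sub_eq_zero.mp h, P.bracket_one_left] at hαs
    exact hsg hαs.symm
  have hα2 : α + 1 ≠ 0 := by
    intro h
    rw [eq_neg_of_add_eq_zero_left h, map_neg, LinearMap.neg_apply, P.bracket_one_left,
      neg_zero] at hαs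
    exact hsg hαs.symm
  obtain ⟨u, hu⟩ : ∃ u, u = (α - 1) / (α + 1) := ⟨_, rfl⟩
  obtain ⟨v, hv⟩ : ∃ v, v = 2 * α * s / g := ⟨_, rfl⟩
  have hαg : P.bracket α g = α * s * g := by
    rw [hg']
    simp only [map_add, map_sub, pow_two, P.leibniz, P.bracket_self, P.bracket_one_right,
      P.bracket_ofNat_right, hαs]
    rw [hg']
    ring
  have hαv : P.bracket α v = v * (α ^ 2 - 1) / 2 := by
    rw [hv, P.bracket_div_right _ _ hg0, P.leibniz, P.leibniz, P.bracket_ofNat_right,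
      P.bracket_self, hαs, hαg]
    field_simp
    rw [hg']
    ring
  have huv : P.bracket u v = u * v := by
    rw [hu, P.bracket_div_left _ _ hα2]
    simp only [map_add, map_sub, LinearMap.add_apply, LinearMap.sub_apply, P.bracket_one_left, hαv]
    field_simp
    ring
  have h1u : 1 - u ≠ 0 := by
    have : 1 - u = 2 / (α + 1) := by rw [hu]; field_simp; ring
    rw [this]
    exact div_ne_zero two_ne_zero hα2
  have h1v : 1 - v ≠ 0 := by
    have : 1 - v = (α - 1) * (α + 1) / g := by
      rw [hv]; field_simp; rw [hg']; ring
    rw [this]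
    exact div_ne_zero (mul_ne_zero hα1 hα2) hg0
  refine ⟨u, v, huv, le_antisymm ?_ ?_⟩
  · have hzK : z ∈ adjoin k {z, s} := subset_adjoin _ _ (by simp)
    have hsK : s ∈ adjoin k {z, s} := subset_adjoin _ _ (by simp)
    have hαK : α ∈ adjoin k {z, s} := hα ▸ sub_mem hzK hsK
    have h2K : (2 : F) ∈ adjoin k {z, s} := ofNat_mem _ 2
    rw [adjoin_le_iff]
    rintro _ (rfl | rfl)
    · rw [hv, hg]
      exact div_mem (mul_mem (mul_mem h2K hαK) hsK)
        (sub_mem (sub_mem (pow_mem hzK 2) (pow_mem hsK 2)) (one_mem _))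
    · rw [hu]
      exact div_mem (sub_mem hαK (one_mem _)) (add_mem hαK (one_mem _))
  · have hvK : v ∈ adjoin k {v, u} := subset_adjoin _ _ (by simp)
    have huK : u ∈ adjoin k {v, u} := subset_adjoin _ _ (by simp)
    have h2K : (2 : F) ∈ adjoin k {v, u} := ofNat_mem _ 2
    have hαK : α ∈ adjoin k {v, u} := by
      have : α = (1 + u) / (1 - u) := by
        rw [eq_div_iff h1u, hu]; field_simp; ring
      rw [this]
      exact div_mem (add_mem (one_mem _) huK) (sub_mem (one_mem _) huK)
    have hsK : s ∈ adjoin k {v, u} := by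
      have : s = v * (α ^ 2 - 1) / (2 * α * (1 - v)) := by
        rw [eq_div_iff (mul_ne_zero (mul_ne_zero two_ne_zero hα0) h1v), hv]
        field_simp
        rw [hg']
        ring
      rw [this]
      exact div_mem (mul_mem hvK (sub_mem (pow_mem hαK 2) (one_mem _)))
        (mul_mem (mul_mem h2K hαK) (sub_mem (one_mem _) hvK))
    rw [adjoin_le_iff]
    rintro _ (rfl | rfl)
    exacts [hz ▸ add_mem hαK hsK, hsK]

/-- Rational coordinates on the double plane branched along the conic `A² = 4B` and two of its
tangent lines. -/
theorem exists_coordinates_of_double_plane {k F : Type*} [Field k] [Field F] [CharZero F]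
    [Algebra k F] (P : PoissonBracket k F) {A B w : F} (hw : w ≠ 0) (hBA : P.bracket B A = w)
    (hrel : w ^ 2 = (A ^ 2 - 4 * B) * ((B - 2 * A + 4) * (B + 2 * A + 4))) :
    ∃ z s : F, s ≠ 0 ∧ P.bracket z s = s * (z ^ 2 - s ^ 2 - 1) / 2 ∧ P.bracket z s ≠ 0 ∧
      adjoin k {z, s} = adjoin k {A, B, w} := by
  have hAB : P.bracket A B = -w := by rw [P.antisymm, hBA]
  obtain ⟨a, ha⟩ : ∃ a, a = B - 2 * A + 4 := ⟨_, rfl⟩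
  obtain ⟨b, hb⟩ : ∃ b, b = B + 2 * A + 4 := ⟨_, rfl⟩
  obtain ⟨m, hm⟩ : ∃ m, m = B - 4 := ⟨_, rfl⟩
  rw [← ha, ← hb] at hrel
  have ha0 : a ≠ 0 := by rintro h; simp [h, hw] at hrel
  have hb0 : b ≠ 0 := by rintro h; simp [h, hw] at hrel
  have hm0 : m ≠ 0 := by
    intro h
    rw [hm, sub_eq_zero] at h
    rw [h, P.bracket_ofNat_left] at hBA
    exact hw hBA.symm
  have hA4 : 4 - A ≠ 0 := by
    intro h
    rw [sub_eq_zero] at h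
    rw [← h, P.bracket_ofNat_right] at hBA
    exact hw hBA.symm
  obtain ⟨p, hp⟩ : ∃ p, p = a / m := ⟨_, rfl⟩
  obtain ⟨s, hs⟩ : ∃ s, s = 2 * w / (a * b) := ⟨_, rfl⟩
  have hs0 : s ≠ 0 := hs ▸ div_ne_zero (mul_ne_zero two_ne_zero hw) (mul_ne_zero ha0 hb0)
  have hs2 : 1 + s ^ 2 = m ^ 2 / (a * b) := by
    have hw2 : 4 * w ^ 2 = (m ^ 2 - a * b) * (a * b) := by rw [hrel, ha, hb, hm]; ring
    rw [hs]; field_simp; linear_combination hw2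
  have hsum : a + b = 2 * m + 16 := by rw [ha, hb, hm]; ring
  have hab : P.bracket a b = 4 * w := by
    rw [ha, hb]
    simp only [map_add, map_sub, LinearMap.add_apply, LinearMap.sub_apply, P.leibniz,
      P.leibniz_left, P.bracket_self, P.bracket_ofNat_left, P.bracket_ofNat_right, hBA, hAB]
    ring
  have ham : P.bracket a m = 2 * w := by
    rw [ha, hm]
    simp only [map_add, map_sub, LinearMap.add_apply, LinearMap.sub_apply,
      P.leibniz_left, P.bracket_self, P.bracket_ofNat_left, P.bracket_ofNat_right, hAB]
    ring
  have hmb : P.bracket m b = 2 * w := by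
    rw [hb, hm]
    simp only [map_add, LinearMap.sub_apply, map_sub, P.leibniz,
      P.bracket_self, P.bracket_ofNat_left, P.bracket_ofNat_right, hBA]
    ring
  have hma : P.bracket m a = -(2 * w) := by rw [P.antisymm, ham]
  have hpm : P.bracket p m = 2 * w / m := by
    rw [hp, P.bracket_div_left _ _ hm0, P.bracket_self, ham]; field_simp; ring
  have hpa : P.bracket p a = 2 * a * w / m ^ 2 := by
    rw [hp, P.bracket_div_left _ _ hm0, P.bracket_self, hma]; ring
  have hpb : P.bracket p b = (4 * w * m - 2 * a * w) / m ^ 2 := by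
    rw [hp, P.bracket_div_left _ _ hm0, hab, hmb]; ring
  have hps : P.bracket p s = 8 / b := by
    have h := congrArg (P.bracket p) hs2
    rw [map_add, P.bracket_one_right, pow_two, P.leibniz,
      P.bracket_div_right _ _ (mul_ne_zero ha0 hb0), pow_two m, P.leibniz, P.leibniz,
      hpm, hpa, hpb] at h
    have h' : 2 * s * P.bracket p s = 2 * s * (8 / b) := by
      rw [show 2 * s * P.bracket p s = 0 + (P.bracket p s * s + s * P.bracket p s) by ring, h, hs]
      field_simp
      linear_combination 2 * hsum
    exact mul_left_cancel₀ (mul_ne_zero two_ne_zero hs0) h'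
  obtain ⟨z, hz⟩ : ∃ z, z = s / (p - 1) := ⟨_, rfl⟩
  have hr : p - 1 = 2 * (4 - A) / m := by
    rw [hp, ha]; field_simp; rw [hm]; ring
  have hr0 : p - 1 ≠ 0 := hr ▸ div_ne_zero (mul_ne_zero two_ne_zero hA4) hm0
  have hz0 : z ≠ 0 := hz ▸ div_ne_zero hs0 hr0
  have hzs : P.bracket z s = -(s * 8) / (b * (p - 1) ^ 2) := by
    rw [hz, P.bracket_div_left _ _ hr0]
    simp only [map_sub, LinearMap.sub_apply, P.bracket_self, P.bracket_one_left, hps]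
    field_simp
    ring
  refine ⟨z, s, hs0, ?_, ?_, le_antisymm ?_ ?_⟩
  · have hkey : s ^ 2 - (p - 1) ^ 2 * (1 + s ^ 2) = -16 / b := by
      rw [eq_sub_of_add_eq' hs2, add_sub_cancel, hp]
      field_simp
      linear_combination (-a) * hsum
    have : z ^ 2 - s ^ 2 - 1 = -16 / b / (p - 1) ^ 2 := by
      rw [← hkey, hz]; field_simp; ring
    rw [hzs, this]
    field_simp
    ring
  · rw [hzs]
    exact div_ne_zero (neg_ne_zero.mpr (mul_ne_zero hs0 (by norm_num)))
      (mul_ne_zero hb0 (pow_ne_zero 2 hr0))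
  · have hAK : A ∈ adjoin k {A, B, w} := subset_adjoin _ _ (by simp)
    have hBK : B ∈ adjoin k {A, B, w} := subset_adjoin _ _ (by simp)
    have hwK : w ∈ adjoin k {A, B, w} := subset_adjoin _ _ (by simp)
    have h2K : (2 : F) ∈ adjoin k {A, B, w} := ofNat_mem _ 2
    have h4K : (4 : F) ∈ adjoin k {A, B, w} := ofNat_mem _ 4
    have haK : a ∈ adjoin k {A, B, w} := ha ▸ add_mem (sub_mem hBK (mul_mem h2K hAK)) h4K
    have hbK : b ∈ adjoin k {A, B, w} := hb ▸ add_mem (add_mem hBK (mul_mem h2K hAK)) h4K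
    have hpK : p ∈ adjoin k {A, B, w} := hp ▸ div_mem haK (hm ▸ sub_mem hBK h4K)
    have hsK : s ∈ adjoin k {A, B, w} := hs ▸ div_mem (mul_mem h2K hwK) (mul_mem haK hbK)
    rw [adjoin_le_iff]
    rintro _ (rfl | rfl)
    exacts [hz ▸ div_mem hsK (sub_mem hpK (one_mem _)), hsK]
  · have hzK : z ∈ adjoin k {z, s} := subset_adjoin _ _ (by simp)
    have hsK : s ∈ adjoin k {z, s} := subset_adjoin _ _ (by simp)
    have h2K : (2 : F) ∈ adjoin k {z, s} := ofNat_mem _ 2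
    have h4K : (4 : F) ∈ adjoin k {z, s} := ofNat_mem _ 4
    have hpK : p ∈ adjoin k {z, s} := by
      have : p = s / z + 1 := by rw [hz]; field_simp; ring
      rw [this]
      exact add_mem (div_mem hsK hzK) (one_mem _)
    have hqK : b / m ∈ adjoin k {z, s} := by
      have : b / m = (1 + s ^ 2)⁻¹ / p := by rw [hs2, hp]; field_simp
      rw [this]
      exact div_mem (inv_mem (add_mem (one_mem _) (pow_mem hsK 2))) hpK
    have hmK : m ∈ adjoin k {z, s} := by
      have : m = 16 / (p + b / m - 2) := by
        have h16 : p + b / m - 2 = 16 / m := by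
          rw [hp]; field_simp; linear_combination hsum
        rw [h16]; field_simp
      rw [this]
      exact div_mem (ofNat_mem _ 16) (sub_mem (add_mem hpK hqK) h2K)
    have haK : a ∈ adjoin k {z, s} := by
      have : a = p * m := by rw [hp]; field_simp
      rw [this]
      exact mul_mem hpK hmK
    have hbK : b ∈ adjoin k {z, s} := by
      have : b = b / m * m := by field_simp
      rw [this]
      exact mul_mem hqK hmK
    have hAK : A ∈ adjoin k {z, s} := by
      have : A = (b - a) / 4 := by rw [ha, hb]; ring
      rw [this]
      exact div_mem (sub_mem hbK haK) h4K
    have hBK : B ∈ adjoin k {z, s} := by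
      have : B = m + 4 := by rw [hm]; ring
      rw [this]
      exact add_mem hmK h4K
    have hwK : w ∈ adjoin k {z, s} := by
      have : w = s * (a * b) / 2 := by rw [hs]; field_simp
      rw [this]
      exact div_mem (mul_mem hsK (mul_mem haK hbK)) h2K
    rw [adjoin_le_iff]
    rintro _ (rfl | rfl | rfl)
    exacts [hAK, hBK, hwK]

/-- A pair generating a subfield over which `F` is algebraic is algebraically independent when `F`
has transcendence degree two. -/
theorem algebraicIndependent_pair_of_isAlgebraic {k F : Type*} [Field k] [Field F] [Algebra k F]
    {x y u v : F} (hind : AlgebraicIndependent k ![x, y])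
    (halg : Algebra.IsAlgebraic (adjoin k {u, v}) F) : AlgebraicIndependent k ![u, v] := by
  have hrange : Set.range ![u, v] = {u, v} := Matrix.range_cons_cons_empty u v ![]
  have : Algebra.IsAlgebraic (Algebra.adjoin k (Set.range ![u, v])) F := by
    rw [hrange]
    exact isAlgebraic_adjoin_iff_top.mp halg
  exact (Algebra.IsAlgebraic.isTranscendenceBasis_of_lift_le_trdeg_of_finite k ![u, v]
    (by simpa using hind.lift_cardinalMk_le_trdeg)).1

/-- A purely transcendental field on `x, y` is isomorphic to any subfield generated by an
algebraically independent pair. -/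
theorem exists_algEquiv_adjoin_pair {k F : Type*} [Field k] [Field F] [Algebra k F]
    {x y u v : F} (hxy : AlgebraicIndependent k ![x, y]) (hgen : adjoin k {x, y} = ⊤)
    (huv : AlgebraicIndependent k ![u, v]) :
    ∃ e : F ≃ₐ[k] adjoin k {u, v}, (e x : F) = u ∧ (e y : F) = v := by
  have hrange : ∀ a b : F, Set.range ![a, b] = {a, b} :=
    fun a b => Matrix.range_cons_cons_empty a b ![]
  have htop : adjoin k (Set.range ![x, y]) = ⊤ := by rw [hrange, hgen]
  let e₁ : FractionRing (MvPolynomial (Fin 2) k) ≃ₐ[k] F :=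
    (hxy.aevalEquivField.trans (equivOfEq htop)).trans topEquiv
  let e₂ : FractionRing (MvPolynomial (Fin 2) k) ≃ₐ[k] adjoin k {u, v} :=
    huv.aevalEquivField.trans (equivOfEq (by rw [hrange]))
  have h₁ : ∀ i, e₁ (algebraMap _ _ (MvPolynomial.X i)) = ![x, y] i := fun i =>
    (hxy.aevalEquivField_algebraMap_apply_coe _).trans (MvPolynomial.aeval_X _ i)
  have h₂ : ∀ i, (e₂ (algebraMap _ _ (MvPolynomial.X i)) : F) = ![u, v] i := fun i =>
    (huv.aevalEquivField_algebraMap_apply_coe _).trans (MvPolynomial.aeval_X _ i)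
  refine ⟨e₁.symm.trans e₂, ?_, ?_⟩
  · rw [AlgEquiv.trans_apply, show e₁.symm x = _ from e₁.symm_apply_eq.mpr (h₁ 0).symm]
    exact h₂ 0
  · rw [AlgEquiv.trans_apply, show e₁.symm y = _ from e₁.symm_apply_eq.mpr (h₁ 1).symm]
    exact h₂ 1

/-- Generators of the field of invariants of the order four automorphism `x ↦ y⁻¹`, `y ↦ x`, and
the algebraicity of the whole field over it. -/
theorem exists_invariants_generating_fixed {k F : Type*} [Field k] [Field F] [CharZero F]
    [Algebra k F] {x y : F} (hgen : adjoin k {x, y} = ⊤) (P : PoissonBracket k F)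
    (hP : P.bracket y x = y * x) (hx : x ≠ 0) (hy : y ≠ 0)
    (ρ : F ≃ₐ[k] F) (hρx : ρ x = y⁻¹) (hρy : ρ y = x) :
    ∃ A B w : F, w ≠ 0 ∧ P.bracket B A = w ∧
      w ^ 2 = (A ^ 2 - 4 * B) * ((B - 2 * A + 4) * (B + 2 * A + 4)) ∧
      (∀ f, f ∈ adjoin k {A, B, w} ↔ ρ f = f) ∧
      Algebra.IsAlgebraic (adjoin k {A, B, w}) F := by
  have hP' : P.bracket x y = -(y * x) := by rw [P.antisymm, hP]
  have hyx : y * x ≠ 0 := mul_ne_zero hy hx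
  obtain ⟨A, hA⟩ : ∃ A, A = x + x⁻¹ + (y + y⁻¹) := ⟨_, rfl⟩
  obtain ⟨B, hB⟩ : ∃ B, B = (x + x⁻¹) * (y + y⁻¹) := ⟨_, rfl⟩
  obtain ⟨w, hw⟩ : ∃ w, w = (x + x⁻¹ - (y + y⁻¹)) * ((x - x⁻¹) * (y - y⁻¹)) := ⟨_, rfl⟩
  have hx1 : x - 1 ≠ 0 := fun h => hyx <| by
    rw [← hP, sub_eq_zero.mp h, P.bracket_one_right]
  have hx2 : x + 1 ≠ 0 := fun h => hyx <| by
    rw [← hP, eq_neg_of_add_eq_zero_left h, map_neg, P.bracket_one_right, neg_zero]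
  have hy1 : y - 1 ≠ 0 := fun h => hyx <| by
    rw [← hP, sub_eq_zero.mp h, P.bracket_one_left]
  have hy2 : y + 1 ≠ 0 := fun h => hyx <| by
    rw [← hP, eq_neg_of_add_eq_zero_left h, map_neg, LinearMap.neg_apply, P.bracket_one_left,
      neg_zero]
  have hne : x - y ≠ 0 := fun h => hyx <| by
    rw [← hP, sub_eq_zero.mp h, P.bracket_self]
  have hxy1 : x * y - 1 ≠ 0 := fun h => hyx <| by
    rw [← hP, eq_inv_of_mul_eq_one_left (sub_eq_zero.mp h), P.bracket_inv_right, P.bracket_self,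
      neg_zero, zero_div]
  have hX : x - x⁻¹ ≠ 0 := by
    have : x - x⁻¹ = (x - 1) * (x + 1) / x := by field_simp; ring
    rw [this]
    exact div_ne_zero (mul_ne_zero hx1 hx2) hx
  have hY : y - y⁻¹ ≠ 0 := by
    have : y - y⁻¹ = (y - 1) * (y + 1) / y := by field_simp; ring
    rw [this]
    exact div_ne_zero (mul_ne_zero hy1 hy2) hy
  have hXY : x + x⁻¹ - (y + y⁻¹) ≠ 0 := by
    have : x + x⁻¹ - (y + y⁻¹) = (x - y) * (x * y - 1) / (x * y) := by field_simp; ring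
    rw [this]
    exact div_ne_zero (mul_ne_zero hne hxy1) (mul_ne_zero hx hy)
  have hAK : A ∈ adjoin k {A, B, w} := subset_adjoin _ _ (by simp)
  have hBK : B ∈ adjoin k {A, B, w} := subset_adjoin _ _ (by simp)
  have hwK : w ∈ adjoin k {A, B, w} := subset_adjoin _ _ (by simp)
  have hCK : B + 2 ∈ adjoin k {A, B, w} := add_mem hBK (ofNat_mem _ 2)
  have hquartic : x ^ 4 = A * x ^ 3 - (B + 2) * x ^ 2 + A * x - 1 := by
    rw [hA, hB]; field_simp; ring
  have htop : (adjoin k {A, B, w})⟮x⟯ = ⊤ := by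
    have hxK : x ∈ (adjoin k {A, B, w})⟮x⟯ := mem_adjoin_simple_self _ x
    have hAx : A ∈ (adjoin k {A, B, w})⟮x⟯ :=
      IntermediateField.algebraMap_mem _ (⟨A, hAK⟩ : adjoin k {A, B, w})
    have hwx : w ∈ (adjoin k {A, B, w})⟮x⟯ :=
      IntermediateField.algebraMap_mem _ (⟨w, hwK⟩ : adjoin k {A, B, w})
    have hyK : y ∈ (adjoin k {A, B, w})⟮x⟯ := by
      have hXx := add_mem hxK (inv_mem hxK)
      have hYx := sub_mem hAx hXx
      have : y = ((A - (x + x⁻¹)) + w / ((x + x⁻¹ - (A - (x + x⁻¹))) * (x - x⁻¹))) / 2 := by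
        have h1 : A - (x + x⁻¹) = y + y⁻¹ := by rw [hA]; ring
        have h2 : w / ((x + x⁻¹ - (y + y⁻¹)) * (x - x⁻¹)) = y - y⁻¹ := by
          rw [div_eq_iff (mul_ne_zero hXY hX), hw]; ring
        rw [h1, h2]; ring
      rw [this]
      exact div_mem (add_mem hYx (div_mem hwx (mul_mem (sub_mem hXx hYx)
        (sub_mem hxK (inv_mem hxK))))) (ofNat_mem _ 2)
    have hle : adjoin k {x, y} ≤ (adjoin k {A, B, w})⟮x⟯.restrictScalars k := by
      rw [adjoin_le_iff]
      rintro _ (rfl | rfl)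
      exacts [hxK, hyK]
    rw [hgen, top_le_iff] at hle
    exact restrictScalars_eq_top_iff.mp hle
  have hfix : ∀ a ∈ adjoin k {A, B, w}, ρ a = a := by
    intro a ha
    induction ha using adjoin_induction with
    | mem a ha =>
      rcases ha with rfl | rfl | rfl
      · rw [hA]; simp only [map_add, map_inv₀, hρx, hρy, inv_inv]; ring
      · rw [hB]; simp only [map_add, map_mul, map_inv₀, hρx, hρy, inv_inv]; ring
      · rw [hw]; simp only [map_add, map_sub, map_mul, map_inv₀, hρx, hρy, inv_inv]; ring
    | algebraMap r => exact ρ.commutes r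
    | add a b _ _ ha hb => rw [map_add, ha, hb]
    | inv a _ ha => rw [map_inv₀, ha]
    | mul a b _ _ ha hb => rw [map_mul, ha, hb]
  refine ⟨A, B, w, hw ▸ mul_ne_zero hXY (mul_ne_zero hX hY), ?_, ?_,
    fun f => ⟨hfix f, fun hf => ?_⟩, ?_⟩
  · rw [hA, hB, hw]
    simp only [map_add, LinearMap.add_apply, P.leibniz_left, P.bracket_self, P.bracket_inv_left,
      P.bracket_inv_right, hP, hP']
    field_simp
    ring
  · rw [hA, hB, hw]
    field_simp
    ring
  · refine mem_of_fixed_of_quartic _ ρ hfix x htop hAK hCK hquartic (fun n hn => ?_) hf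
    have hsum : x ^ n + ρ (x ^ n) + ρ (ρ (x ^ n)) + ρ (ρ (ρ (x ^ n))) =
        x ^ n + y⁻¹ ^ n + x⁻¹ ^ n + y ^ n := by
      simp only [map_pow, map_inv₀, hρx, hρy, inv_inv]
    rw [hsum]
    interval_cases n
    · convert ofNat_mem (adjoin k {A, B, w}) 4 using 1
      norm_num
    · convert hAK using 1
      rw [hA]; ring
    · convert sub_mem (pow_mem hAK 2) (mul_mem (ofNat_mem _ 2) hCK) using 1
      rw [hA, hB]; field_simp; ring
    · convert add_mem (sub_mem (pow_mem hAK 3) (mul_mem (ofNat_mem _ 3) (mul_mem hAK hCK)))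
        (mul_mem (ofNat_mem _ 3) hAK) using 1
      rw [hA, hB]; field_simp; ring
  · have hint := isIntegral_of_quartic hAK hCK hquartic
    have := isAlgebraic_adjoin_simple hint
    rw [htop] at this
    exact (topEquiv (F := adjoin k {A, B, w}) (E := F)).isAlgebraic

/-- Let `k` be a field of characteristic zero, let `F = k(x,y)` carry the
Poisson bracket with `{y,x} = yx`, and let `ρ` be the `k`-algebra automorphism of `F` with
`ρ(x) = y⁻¹`, `ρ(y) = x` (a Poisson monomial automorphism of order 4).  Then the fixed field
`F^ρ` is Poisson-isomorphic to `F`. -/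
theorem statement2
    (k : Type*) [Field k] [CharZero k]
    (F : Type*) [Field F] [Algebra k F] (x y : F)
    (hind : AlgebraicIndependent k ![x, y])
    (hgen : IntermediateField.adjoin k {x, y} = ⊤)
    (P : PoissonBracket k F) (hP : P.bracket y x = y * x)
    (ρ : F ≃ₐ[k] F) (hρx : ρ x = y⁻¹) (hρy : ρ y = x)
    (hρP : ∀ a b : F, ρ (P.bracket a b) = P.bracket (ρ a) (ρ b)) :
    ∃ e : ↥(fixedSubalgebra ρ) ≃ₐ[k] F,
      ∀ (u v : ↥(fixedSubalgebra ρ)) (huv : P.bracket (u : F) (v : F) ∈ fixedSubalgebra ρ),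
        e ⟨P.bracket (u : F) (v : F), huv⟩ = P.bracket (e u) (e v) := by
  have : CharZero F := charZero_of_injective_algebraMap (algebraMap k F).injective
  obtain ⟨A, B, w, hw, hBA, hrel, hmem, halg⟩ := exists_invariants_generating_fixed hgen P hP
    (hind.ne_zero 0) (hind.ne_zero 1) ρ hρx hρy
  obtain ⟨z, s, hs, hzs, hne, hzsK⟩ := exists_coordinates_of_double_plane P hw hBA hrel
  obtain ⟨u, v, huv, hK⟩ := exists_generators_of_bracket_eq P hs hzs hne
  rw [hzsK] at hK
  rw [← hK] at halg
  obtain ⟨e, hex, hey⟩ := exists_algEquiv_adjoin_pair hind hgen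
    (algebraicIndependent_pair_of_isAlgebraic hind halg)
  have hfixed : (adjoin k {v, u}).toSubalgebra = fixedSubalgebra ρ :=
    SetLike.ext fun f => by rw [hK]; exact hmem f
  let e' : F ≃ₐ[k] fixedSubalgebra ρ := e.trans (Subalgebra.equivOfEq _ _ hfixed)
  have he' : ∀ a b, (e' (P.bracket a b) : F) = P.bracket (e' a) (e' b) :=
    P.map_bracket_of_generators hgen ((fixedSubalgebra ρ).val.comp e'.toAlgHom) <| by
      change (e (P.bracket y x) : F) = P.bracket (e y) (e x)
      rw [hP, map_mul, MulMemClass.coe_mul, hex, hey, huv]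
  refine ⟨e'.symm, fun a b hab => ?_⟩
  rw [AlgEquiv.symm_apply_eq]
  apply Subtype.ext
  rw [he', e'.apply_symm_apply, e'.apply_symm_apply]
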